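/- Let α ∈ (0,1) and r = √(1−α²). Then min_{x ∈ [−r,r]} U^{μ_α}(x) − min_{x ∈ [−1,1]} U^{μ_α}(x) = C(α), where C(α) = ((1+α)·log(1+α) + (1−α)·log(1−α))/2. -/

import Mathlib

open MeasureTheory Polynomial Filter Set

/-- The `n`-grid: `n` equally spaced points in `[-1,1]` including the endpoints. -/
noncomputable def nGrid (n : ℕ) : Set ℝ :=
  {x | ∃ k : ℕ, 1 ≤ k ∧ k ≤ n ∧ x = (2 * (k : ℝ) - n - 1) / ((n : ℝ) - 1)}

/-- Uniform norm of a real polynomial on the interval `[-1,1]`. -/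
noncomputable def normI (p : Polynomial ℝ) : ℝ :=
  sSup ((fun x => |p.eval x|) '' Set.Icc (-1 : ℝ) 1)

/-- Uniform norm of a real polynomial on the `n`-grid. -/
noncomputable def normE (n : ℕ) (p : Polynomial ℝ) : ℝ :=
  sSup ((fun x => |p.eval x|) '' nGrid n)

/-- The constant `C(α)`. -/
noncomputable def Cconst (α : ℝ) : ℝ :=
  ((1 + α) * Real.log (1 + α) + (1 - α) * Real.log (1 - α)) / 2

/-- The constraining measure `σ`: density `1/2` w.r.t. Lebesgue measure on `[-1,1]`. -/
noncomputable def sigmaM : Measure ℝ :=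
  (2 : ENNReal)⁻¹ • (volume.restrict (Set.Icc (-1 : ℝ) 1))

/-- Logarithmic potential of a measure on `ℝ`. -/
noncomputable def logPot (μ : Measure ℝ) (x : ℝ) : ℝ :=
  ∫ y, Real.log (1 / |x - y|) ∂μ

/-- Topological support of a measure on `ℝ`. -/
def msupport (μ : Measure ℝ) : Set ℝ :=
  {x | ∀ U : Set ℝ, IsOpen U → x ∈ U → μ U ≠ 0}

/-- Normalized zero counting measure (zeros counted with multiplicity,
normalized by `1/n`). -/
noncomputable def zeroMeasure (n : ℕ) (p : Polynomial ℝ) : Measure ℝ :=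
  ((n : ENNReal))⁻¹ • (p.roots.map (fun x => MeasureTheory.Measure.dirac x)).sum

/-- Density of the constrained equilibrium measure `μ_α` (with `r = √(1-α²)`). -/
noncomputable def mualphaDensity (α x : ℝ) : ℝ :=
  if |x| < Real.sqrt (1 - α ^ 2) then
    (1 / Real.pi) * Real.arctan (α / Real.sqrt ((1 - α ^ 2) - x ^ 2))
  else (1 : ℝ) / 2

/-- The constrained equilibrium measure `μ_α` on `[-1,1]`. -/
noncomputable def mualpha (α : ℝ) : Measure ℝ :=
  (volume.restrict (Set.Icc (-1 : ℝ) 1)).withDensity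
    (fun x => ENNReal.ofReal (mualphaDensity α x))

open Real in
lemma circleMap_sub_mul_sub_inv {x : ℝ} {z : ℂ} (hz : z ≠ 0) (hx : z + z⁻¹ = 2 * (x : ℂ)) (θ : ℝ) :
    (circleMap 0 1 θ - z) * (circleMap 0 1 θ - z⁻¹) =
      -(2 * circleMap 0 1 θ * ((x - cos θ : ℝ) : ℂ)) := by
  have h : circleMap 0 1 θ ^ 2 + 1 = 2 * circleMap 0 1 θ * Complex.cos θ := by
    have h' : Complex.exp (-θ * Complex.I) = (Complex.exp (θ * Complex.I))⁻¹ := by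
      rw [← Complex.exp_neg]; congr 1; ring
    rw [Complex.cos, circleMap, h']
    field_simp
    push_cast
    ring
  push_cast
  linear_combination h - circleMap 0 1 θ * hx + mul_inv_cancel₀ hz

lemma ae_circleMap_ne (z : ℂ) : ∀ᵐ θ : ℝ, circleMap 0 1 θ ≠ z :=
  measure_eq_zero_iff_ae_notMem.mp
    (((Set.countable_singleton z).preimage_circleMap 0 one_ne_zero).measure_zero _)

open Real in
lemma ae_log_abs_sub_cos {x : ℝ} {z : ℂ} (hz : z ≠ 0) (hx : z + z⁻¹ = 2 * (x : ℂ)) :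
    ∀ᵐ θ : ℝ, x - cos θ ≠ 0 ∧ log |x - cos θ| =
      log ‖circleMap 0 1 θ - z‖ + log ‖circleMap 0 1 θ - z⁻¹‖ - log 2 := by
  filter_upwards [ae_circleMap_ne z, ae_circleMap_ne z⁻¹] with θ h1 h2
  have e := congrArg norm (circleMap_sub_mul_sub_inv hz hx θ)
  rw [norm_mul, norm_neg, norm_mul, norm_mul, norm_circleMap_zero, Complex.norm_real,
    Real.norm_eq_abs] at e
  have hne : x - cos θ ≠ 0 := by
    intro h
    rw [h, abs_zero, mul_zero] at e
    simp [sub_eq_zero, h1, h2] at e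
  refine ⟨hne, ?_⟩
  rw [← log_mul (norm_ne_zero_iff.mpr (sub_ne_zero.mpr h1))
    (norm_ne_zero_iff.mpr (sub_ne_zero.mpr h2)), e, abs_one, mul_one,
    log_mul (by norm_num) (abs_ne_zero.mpr hne), Complex.norm_ofNat]
  ring

open Real in
lemma intervalIntegrable_log_norm_circleMap_sub (a : ℂ) :
    IntervalIntegrable (fun θ : ℝ ↦ log ‖circleMap 0 1 θ - a‖) volume 0 (2 * π) :=
  circleIntegrable_log_norm_sub_const (a := a) (c := 0) 1

open Real in
lemma intervalIntegrable_log_abs_sub_cos {x : ℝ} {z : ℂ} (hz : z ≠ 0)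
    (hx : z + z⁻¹ = 2 * (x : ℂ)) :
    IntervalIntegrable (fun θ : ℝ ↦ log |x - cos θ|) volume 0 (2 * π) :=
  (((intervalIntegrable_log_norm_circleMap_sub z).add
    (intervalIntegrable_log_norm_circleMap_sub z⁻¹)).sub
    (intervalIntegrable_const (c := log 2))).congr_ae
      (ae_restrict_of_ae (by
        filter_upwards [ae_log_abs_sub_cos hz hx] with θ hθ
        rw [hθ.2]))

open Real in
/-- The Joukowski substitution evaluates the logarithmic integral of the arcsine law. -/
lemma integral_log_abs_sub_cos {x : ℝ} {z : ℂ} (hz : z ≠ 0) (hx : z + z⁻¹ = 2 * (x : ℂ)) :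
    ∫ θ in (0 : ℝ)..π, log |x - cos θ| = π * (|log ‖z‖| - log 2) := by
  have int1 := intervalIntegrable_log_norm_circleMap_sub
  have hlog := intervalIntegrable_log_abs_sub_cos hz hx
  have avg (a : ℂ) : ∫ θ in (0 : ℝ)..2 * π, log ‖circleMap 0 1 θ - a‖ = 2 * π * log⁺ ‖a‖ := by
    have h := circleAverage_log_norm_sub_const_eq_posLog (a := a)
    rw [circleAverage_def, smul_eq_mul] at h
    rw [← h]
    field_simp
  have full : ∫ θ in (0 : ℝ)..2 * π, log |x - cos θ| = 2 * π * (|log ‖z‖| - log 2) := by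
    rw [intervalIntegral.integral_congr_ae
        (by filter_upwards [ae_log_abs_sub_cos hz hx] with θ hθ _ using hθ.2),
      intervalIntegral.integral_sub ((int1 z).add (int1 z⁻¹)) (by simp),
      intervalIntegral.integral_add (int1 z) (int1 z⁻¹), avg, avg]
    have : log⁺ ‖z‖ + log⁺ ‖z⁻¹‖ = |log ‖z‖| := by
      rw [norm_inv]
      change max 0 (log ‖z‖) + max 0 (log ‖z‖⁻¹) = |log ‖z‖|
      rw [log_inv]
      rcases le_total 0 (log ‖z‖) with h | h
      · rw [max_eq_right h, max_eq_left (by linarith), abs_of_nonneg h, add_zero]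
      · rw [max_eq_left h, max_eq_right (by linarith), abs_of_nonpos h, zero_add]
    rw [← this]
    simp
    ring
  have split := intervalIntegral.integral_add_adjacent_intervals
    (hlog.mono_set (a := 0) (b := 2 * π) (c := 0) (d := π) (by
      rw [uIcc_of_le pi_pos.le, uIcc_of_le two_pi_pos.le]
      exact Icc_subset_Icc_right (by linarith [pi_pos])))
    (hlog.mono_set (a := 0) (b := 2 * π) (c := π) (d := 2 * π) (by
      rw [uIcc_of_le (by linarith [pi_pos]), uIcc_of_le two_pi_pos.le]
      exact Icc_subset_Icc_left pi_pos.le))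
  have hrefl := intervalIntegral.integral_comp_sub_left (a := 0) (b := π)
    (fun θ ↦ log |x - cos θ|) (2 * π)
  simp only [cos_two_pi_sub, sub_zero, show 2 * π - π = π by ring] at hrefl
  linarith

open Real in
/-- The logarithmic integral of the arcsine law on `[-R, R]`, in terms of the Joukowski
parameter `z` of `x / R`. -/
lemma integral_log_abs_sub_mul_inv_sqrt {R x : ℝ} (hR : 0 < R) (hR1 : R ≤ 1) {z : ℂ}
    (hz : z ≠ 0) (hx : z + z⁻¹ = 2 * ((x / R : ℝ) : ℂ)) :
    ∫ y in Icc (-1 : ℝ) 1, log |x - y| * (√(R ^ 2 - y ^ 2))⁻¹ =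
      π * (log R + |log ‖z‖| - log 2) := by
  rw [setIntegral_eq_of_subset_of_forall_sdiff_eq_zero (s := Ioc (-R) R) measurableSet_Icc
    (fun y hy ↦ ⟨by linarith [hy.1], by linarith [hy.2]⟩)]
  swap
  · intro y hy
    have : R ^ 2 - y ^ 2 ≤ 0 := by
      have : R ≤ |y| := by
        by_contra! h
        exact hy.2 ⟨(abs_lt.mp h).1, (abs_lt.mp h).2.le⟩
      nlinarith [sq_abs y]
    rw [sqrt_eq_zero_of_nonpos this]
    simp
  rw [← intervalIntegral.integral_of_le (by linarith)]
  have h1 := intervalIntegral.integral_comp_mul_left (a := -1) (b := 1)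
    (fun y ↦ log |x - y| * (√(R ^ 2 - y ^ 2))⁻¹) hR.ne'
  have h2 := Polynomial.Chebyshev.integral_measureT_eq_integral_cos
    (f := fun u ↦ log |x - R * u|)
  rw [Polynomial.Chebyshev.integral_measureT] at h2
  have h3 : ∫ u in (-1 : ℝ)..1, log |x - R * u| * (√(R ^ 2 - (R * u) ^ 2))⁻¹ =
      R⁻¹ * ∫ u in (-1 : ℝ)..1, log |x - R * u| * √(1 - u ^ 2)⁻¹ := by
    rw [← intervalIntegral.integral_const_mul]
    congr 1
    ext u
    rw [show R ^ 2 - (R * u) ^ 2 = R ^ 2 * (1 - u ^ 2) by ring, sqrt_mul (sq_nonneg R),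
      sqrt_sq hR.le, mul_inv]
    rw [sqrt_inv]
    ring
  have h4 : ∫ θ in (0 : ℝ)..π, log |x - R * cos θ| =
      ∫ θ in (0 : ℝ)..π, (log R + log |x / R - cos θ|) := by
    apply intervalIntegral.integral_congr_ae
    filter_upwards [ae_log_abs_sub_cos hz hx] with θ hθ _
    rw [← log_mul hR.ne' (abs_ne_zero.mpr hθ.1)]
    congr 1
    rw [← abs_of_pos hR, ← abs_mul, abs_of_pos hR]
    congr 1
    field_simp
  have h5 : IntervalIntegrable (fun θ : ℝ ↦ log |x / R - cos θ|) volume 0 π :=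
    (intervalIntegrable_log_abs_sub_cos hz hx).mono_set (by
      rw [uIcc_of_le pi_pos.le, uIcc_of_le two_pi_pos.le]
      exact Icc_subset_Icc_right (by linarith [pi_pos]))
  rw [intervalIntegral.integral_add intervalIntegrable_const h5, integral_log_abs_sub_cos hz hx,
    intervalIntegral.integral_const, smul_eq_mul, sub_zero] at h4
  rw [h3, h2, h4, smul_eq_mul, mul_neg_one, mul_one] at h1
  rw [← mul_left_cancel₀ (inv_ne_zero hR.ne') h1]
  ring

open Real in
lemma hasDeriv_arcsin_div {a t : ℝ} (ha : 0 < a) (ht : 0 ≤ t) :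
    HasDerivWithinAt (fun t ↦ arcsin (t / a)) (√(a ^ 2 - t ^ 2))⁻¹ (Ioi t) t := by
  have h := (hasDerivWithinAt_arcsin_Ici (x := t / a)
    (by have : 0 ≤ t / a := by positivity
        linarith)).comp t
    ((hasDerivWithinAt_id t (Ioi t)).div_const a)
    (fun s hs ↦ by simp only [mem_Ici, id]; gcongr; exact (mem_Ioi.mp hs).le)
  refine h.congr_deriv ?_
  rw [show a ^ 2 - t ^ 2 = a ^ 2 * (1 - (t / a) ^ 2) by field_simp, sqrt_mul (sq_nonneg a),
    sqrt_sq ha.le, mul_inv]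
  ring

open Real in
lemma integrableOn_inv_sqrt {a : ℝ} (ha : 0 < a) (α : ℝ) :
    IntegrableOn (fun t ↦ (√(a ^ 2 - t ^ 2))⁻¹) (Ioc 0 α) :=
  intervalIntegral.integrableOn_deriv_right_of_nonneg
    (g := fun t ↦ arcsin (t / a)) (by fun_prop)
    (fun t ht ↦ hasDeriv_arcsin_div ha ht.1.le) (fun t _ ↦ by positivity)

open Real in
lemma setIntegral_inv_sqrt {a α : ℝ} (ha : 0 < a) (hα : 0 ≤ α) :
    ∫ t in Ioc 0 α, (√(a ^ 2 - t ^ 2))⁻¹ = arcsin (α / a) := by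
  rw [← intervalIntegral.integral_of_le hα,
    intervalIntegral.integral_eq_sub_of_hasDeriv_right_of_le hα
      (f := fun t ↦ arcsin (t / a)) (by fun_prop)
      (fun t ht ↦ hasDeriv_arcsin_div ha ht.1.le)
      ((intervalIntegrable_iff_integrableOn_Ioc_of_le hα).mpr (integrableOn_inv_sqrt ha α))]
  simp

open Real in
lemma mualphaDensity_eq_arcsin {α y : ℝ} (hα : α ∈ Ioo (0 : ℝ) 1) (hy : y ∈ Ioo (-1 : ℝ) 1) :
    mualphaDensity α y = π⁻¹ * arcsin (α / √(1 - y ^ 2)) := by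
  obtain ⟨h0, h1⟩ := hα
  have hy2 : 0 < 1 - y ^ 2 := by nlinarith [hy.1, hy.2]
  have hs : 0 < √(1 - y ^ 2) := sqrt_pos.mpr hy2
  rw [mualphaDensity]
  split_ifs with h
  · rw [lt_sqrt (abs_nonneg y), sq_abs] at h
    have hu : α < √(1 - y ^ 2) := lt_sqrt_of_sq_lt (by linarith)
    have h3 : 0 < α / √(1 - y ^ 2) := by positivity
    rw [arcsin_eq_arctan ⟨by linarith, (div_lt_one hs).mpr hu⟩, one_div, div_pow,
      sq_sqrt hy2.le, one_sub_div hy2.ne', sqrt_div (by linarith), div_div_div_cancel_right₀ hs.ne']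
    rw [show 1 - y ^ 2 - α ^ 2 = 1 - α ^ 2 - y ^ 2 by ring]
  · rw [not_lt, sqrt_le_left (abs_nonneg y), sq_abs] at h
    rw [arcsin_of_one_le]
    · field_simp
    · rw [one_le_div hs]
      exact sqrt_le_iff.mpr ⟨h0.le, by linarith⟩

lemma mualphaDensity_nonneg {α : ℝ} (hα : 0 < α) (y : ℝ) : 0 ≤ mualphaDensity α y := by
  rw [mualphaDensity]
  split_ifs
  · exact mul_nonneg (by positivity) (Real.arctan_nonneg.mpr (by positivity))
  · norm_num

lemma mualphaDensity_le_half (α y : ℝ) : mualphaDensity α y ≤ 1 / 2 := by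
  rw [mualphaDensity]
  split_ifs
  · rw [one_div, inv_mul_le_iff₀ Real.pi_pos]
    linarith [Real.arctan_lt_pi_div_two (α / √(1 - α ^ 2 - y ^ 2))]
  · exact le_rfl

lemma measurable_mualphaDensity (α : ℝ) : Measurable (mualphaDensity α) :=
  Measurable.ite (measurableSet_lt (by fun_prop) (by fun_prop)) (by fun_prop) (by fun_prop)

lemma integrableOn_log_abs_sub (x : ℝ) :
    IntegrableOn (fun y ↦ Real.log |x - y|) (Icc (-1 : ℝ) 1) := by
  have h := (intervalIntegral.intervalIntegrable_log' (a := x + 1) (b := x - 1)).comp_sub_left x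
  rw [show x - (x + 1) = -1 by ring, show x - (x - 1) = 1 by ring,
    intervalIntegrable_iff_integrableOn_Icc_of_le (by norm_num)] at h
  simpa only [Real.log_abs] using h

/-- The integrand of the representation of `μ_α` as a mixture of arcsine laws. -/
noncomputable def arcsineKernel (x t y : ℝ) : ℝ :=
  Real.log |x - y| * (√(1 - t ^ 2 - y ^ 2))⁻¹

lemma ae_mem_Ioo_neg_one_one : ∀ᵐ y ∂volume.restrict (Icc (-1 : ℝ) 1), y ∈ Ioo (-1 : ℝ) 1 := by
  rw [← restrict_Ioo_eq_restrict_Icc]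
  exact ae_restrict_mem measurableSet_Ioo

lemma sq_sqrt_one_sub_sq_sub {y : ℝ} (hy : y ∈ Ioo (-1 : ℝ) 1) (t : ℝ) :
    √(1 - y ^ 2) ^ 2 - t ^ 2 = 1 - t ^ 2 - y ^ 2 := by
  rw [Real.sq_sqrt (by nlinarith [hy.1, hy.2])]
  ring

lemma setIntegral_inv_sqrt_eq_density {α y : ℝ} (hα : α ∈ Ioo (0 : ℝ) 1)
    (hy : y ∈ Ioo (-1 : ℝ) 1) :
    ∫ t in Ioc 0 α, (√(1 - t ^ 2 - y ^ 2))⁻¹ = Real.pi * mualphaDensity α y := by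
  have hs : 0 < √(1 - y ^ 2) := Real.sqrt_pos.mpr (by nlinarith [hy.1, hy.2])
  have h := setIntegral_inv_sqrt hs hα.1.le
  simp only [sq_sqrt_one_sub_sq_sub hy] at h
  rw [h, mualphaDensity_eq_arcsin hα hy]
  field_simp

lemma integrable_arcsineKernel {α : ℝ} (hα : α ∈ Ioo (0 : ℝ) 1) (x : ℝ) :
    Integrable (Function.uncurry (arcsineKernel x))
      ((volume.restrict (Ioc 0 α)).prod (volume.restrict (Icc (-1 : ℝ) 1))) := by
  have hm : Measurable (Function.uncurry (arcsineKernel x)) := by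
    unfold arcsineKernel Function.uncurry
    fun_prop
  rw [integrable_prod_iff' hm.aestronglyMeasurable]
  constructor
  · filter_upwards [ae_mem_Ioo_neg_one_one] with y hy
    have hs : 0 < √(1 - y ^ 2) := Real.sqrt_pos.mpr (by nlinarith [hy.1, hy.2])
    have h := integrableOn_inv_sqrt hs α
    simp only [sq_sqrt_one_sub_sq_sub hy] at h
    exact Integrable.const_mul h (Real.log |x - y|)
  · have h : Integrable (fun y ↦ Real.pi * (mualphaDensity α y * |Real.log (|x - y|)|))
        (volume.restrict (Icc (-1 : ℝ) 1)) := by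
      refine Integrable.const_mul ?_ _
      refine (integrableOn_log_abs_sub x).abs.bdd_mul (c := 1 / 2)
        (measurable_mualphaDensity α).aestronglyMeasurable (ae_of_all _ fun y ↦ ?_)
      rw [Real.norm_of_nonneg (mualphaDensity_nonneg hα.1 y)]
      exact mualphaDensity_le_half α y
    refine h.congr ?_
    filter_upwards [ae_mem_Ioo_neg_one_one] with y hy
    simp only [Function.uncurry, arcsineKernel, norm_mul, norm_inv, Real.norm_eq_abs,
      abs_of_nonneg (Real.sqrt_nonneg _)]
    rw [integral_const_mul, setIntegral_inv_sqrt_eq_density hα hy]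
    ring

/-- Disintegration of the potential of `μ_α` into potentials of arcsine laws. -/
lemma logPot_mualpha {α : ℝ} (hα : α ∈ Ioo (0 : ℝ) 1) (x : ℝ) :
    logPot (mualpha α) x =
      -(Real.pi⁻¹ * ∫ t in Ioc 0 α, ∫ y in Icc (-1 : ℝ) 1, arcsineKernel x t y) := by
  rw [integral_integral_swap (integrable_arcsineKernel hα x), logPot, mualpha,
    integral_withDensity_eq_integral_toReal_smul
      (measurable_mualphaDensity α).ennreal_ofReal (by simp), ← integral_const_mul,
    ← integral_neg]
  refine integral_congr_ae ?_
  filter_upwards [ae_mem_Ioo_neg_one_one] with y hy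
  simp only [arcsineKernel]
  rw [integral_const_mul, setIntegral_inv_sqrt_eq_density hα hy,
    ENNReal.toReal_ofReal (mualphaDensity_nonneg hα.1 y), one_div, Real.log_inv, smul_eq_mul]
  field_simp

open Real in
lemma integral_arcsineKernel_of_abs_le {x t : ℝ} (ht : t ∈ Ioo (0 : ℝ) 1)
    (hx : |x| ≤ √(1 - t ^ 2)) :
    ∫ y in Icc (-1 : ℝ) 1, arcsineKernel x t y = π * (log √(1 - t ^ 2) - log 2) := by
  have h0 : 0 < 1 - t ^ 2 := by nlinarith [ht.1, ht.2]
  have hR : 0 < √(1 - t ^ 2) := sqrt_pos.mpr h0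
  have hR1 : √(1 - t ^ 2) ≤ 1 := sqrt_le_one.mpr (by nlinarith [ht.1])
  set R := √(1 - t ^ 2) with hRdef
  have hz : Complex.exp (arccos (x / R) * Complex.I) +
      (Complex.exp (arccos (x / R) * Complex.I))⁻¹ = 2 * ((x / R : ℝ) : ℂ) := by
    have hxR : |x / R| ≤ 1 := by
      rw [abs_div, abs_of_pos hR]
      exact (div_le_one hR).mpr hx
    rw [abs_le] at hxR
    have h := congrArg ((↑) : ℝ → ℂ) (cos_arccos hxR.1 hxR.2)
    rw [Complex.ofReal_cos, Complex.cos, neg_mul, Complex.exp_neg] at h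
    rw [← h]
    ring
  have h := integral_log_abs_sub_mul_inv_sqrt hR hR1 (Complex.exp_ne_zero _) hz
  rw [Complex.norm_exp_ofReal_mul_I, log_one, abs_zero, add_zero, hRdef, sq_sqrt h0.le] at h
  exact h

open Real in
lemma integral_arcsineKernel_of_sq_eq {x t v : ℝ} (ht : t ∈ Ioo (0 : ℝ) 1)
    (hv : v ^ 2 = x ^ 2 - (1 - t ^ 2)) (hxv : 0 ≤ x * v) :
    ∫ y in Icc (-1 : ℝ) 1, arcsineKernel x t y = π * (log |x + v| - log 2) := by
  have h0 : 0 < 1 - t ^ 2 := by nlinarith [ht.1, ht.2]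
  have hR : 0 < √(1 - t ^ 2) := sqrt_pos.mpr h0
  have hR1 : √(1 - t ^ 2) ≤ 1 := sqrt_le_one.mpr (by nlinarith [ht.1])
  have hRsq : √(1 - t ^ 2) ^ 2 = 1 - t ^ 2 := sq_sqrt h0.le
  set R := √(1 - t ^ 2)
  have hle : R ≤ |x + v| := abs_le_of_sq_le_sq' (by nlinarith [sq_abs (x + v)]) (abs_nonneg _) |>.2
  have hne : x + v ≠ 0 := abs_pos.mp (hR.trans_le hle)
  have hz : (x + v) / R + ((x + v) / R)⁻¹ = 2 * (x / R) := by
    field_simp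
    nlinarith
  have h := integral_log_abs_sub_mul_inv_sqrt hR hR1 (z := (((x + v) / R : ℝ) : ℂ))
    (by exact_mod_cast div_ne_zero hne hR.ne') (by exact_mod_cast hz)
  rw [Complex.norm_real, Real.norm_eq_abs, abs_div, abs_of_pos hR,
    log_div (abs_ne_zero.mpr hne) hR.ne',
    abs_of_nonneg (sub_nonneg.mpr (log_le_log hR hle)), hRsq] at h
  exact h.trans (by ring)

open Real in
lemma integral_arcsineKernel_one {t : ℝ} (ht : t ∈ Ioo (0 : ℝ) 1) :
    ∫ y in Icc (-1 : ℝ) 1, arcsineKernel 1 t y = π * (log (1 + t) - log 2) := by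
  rw [integral_arcsineKernel_of_sq_eq (v := t) ht (by ring) (by linarith [ht.1]),
    abs_of_pos (by linarith [ht.1])]

open Real in
lemma integral_arcsineKernel_le_one {x t : ℝ} (ht : t ∈ Ioo (0 : ℝ) 1) (hx : |x| ≤ 1) :
    ∫ y in Icc (-1 : ℝ) 1, arcsineKernel x t y ≤
      ∫ y in Icc (-1 : ℝ) 1, arcsineKernel 1 t y := by
  have h0 : 0 < 1 - t ^ 2 := by nlinarith [ht.1, ht.2]
  have hR : 0 < √(1 - t ^ 2) := sqrt_pos.mpr h0
  have hR1 : √(1 - t ^ 2) ≤ 1 := sqrt_le_one.mpr (by nlinarith [ht.1])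
  rw [integral_arcsineKernel_one ht]
  rcases le_total |x| √(1 - t ^ 2) with h | h
  · rw [integral_arcsineKernel_of_abs_le ht h]
    gcongr
    linarith [ht.1]
  · have hsq : 1 - t ^ 2 ≤ x ^ 2 := by
      rw [← sq_abs x]
      exact (sqrt_le_left (abs_nonneg x)).mp h
    have hs := sq_sqrt (sub_nonneg.mpr hsq)
    have hst : √(x ^ 2 - (1 - t ^ 2)) ≤ t :=
      sqrt_le_iff.mpr ⟨ht.1.le, by nlinarith [sq_abs x, abs_nonneg x]⟩
    obtain ⟨v, hv, hxv, hvt⟩ : ∃ v, v ^ 2 = x ^ 2 - (1 - t ^ 2) ∧ 0 ≤ x * v ∧ |v| ≤ t := by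
      rcases le_total 0 x with hx0 | hx0
      · exact ⟨_, hs, by positivity, by rwa [abs_of_nonneg (sqrt_nonneg _)]⟩
      · exact ⟨-√(x ^ 2 - (1 - t ^ 2)), by rw [neg_sq, hs],
          mul_nonneg_of_nonpos_of_nonpos hx0 (neg_nonpos.mpr (sqrt_nonneg _)),
          by rwa [abs_neg, abs_of_nonneg (sqrt_nonneg _)]⟩
    rw [integral_arcsineKernel_of_sq_eq ht hv hxv]
    have hpos : 0 < |x + v| := abs_pos.mpr fun h' ↦ by nlinarith
    gcongr
    linarith [abs_add_le x v]

lemma integrableOn_integral_arcsineKernel {α : ℝ} (hα : α ∈ Ioo (0 : ℝ) 1) (x : ℝ) :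
    IntegrableOn (fun t ↦ ∫ y in Icc (-1 : ℝ) 1, arcsineKernel x t y) (Ioc 0 α) :=
  (integrable_arcsineKernel hα x).integral_prod_left

lemma logPot_mualpha_one_le {α x : ℝ} (hα : α ∈ Ioo (0 : ℝ) 1) (hx : |x| ≤ 1) :
    logPot (mualpha α) 1 ≤ logPot (mualpha α) x := by
  rw [logPot_mualpha hα, logPot_mualpha hα, neg_le_neg_iff]
  refine mul_le_mul_of_nonneg_left ?_ (inv_nonneg.mpr Real.pi_pos.le)
  exact setIntegral_mono_on (integrableOn_integral_arcsineKernel hα x)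
    (integrableOn_integral_arcsineKernel hα 1) measurableSet_Ioc
    fun t ht ↦ integral_arcsineKernel_le_one ⟨ht.1, ht.2.trans_lt hα.2⟩ hx

lemma logPot_mualpha_eq_zero {α x : ℝ} (hα : α ∈ Ioo (0 : ℝ) 1) (hx : |x| ≤ √(1 - α ^ 2)) :
    logPot (mualpha α) x = logPot (mualpha α) 0 := by
  rw [logPot_mualpha hα, logPot_mualpha hα]
  congr 2
  refine setIntegral_congr_fun measurableSet_Ioc fun t ht ↦ ?_
  have ht' : t ∈ Ioo (0 : ℝ) 1 := ⟨ht.1, ht.2.trans_lt hα.2⟩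
  have hle : √(1 - α ^ 2) ≤ √(1 - t ^ 2) := by
    have := ht.1
    have := ht.2
    gcongr
  rw [integral_arcsineKernel_of_abs_le ht' (hx.trans hle),
    integral_arcsineKernel_of_abs_le ht' (by simp)]

open Real in
lemma logPot_mualpha_zero_sub_one {α : ℝ} (hα : α ∈ Ioo (0 : ℝ) 1) :
    logPot (mualpha α) 0 - logPot (mualpha α) 1 = Cconst α := by
  have hderiv : ∀ t ∈ uIcc 0 α,
      HasDerivAt Cconst ((log (1 + t) - log (1 - t)) / 2) t := by
    intro t ht
    rw [uIcc_of_le hα.1.le] at ht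
    have h1 : 1 + t ≠ 0 := by linarith [ht.1]
    have h2 : 1 - t ≠ 0 := by linarith [ht.2, hα.2]
    have d1 := (hasDerivAt_mul_log h1).comp t ((hasDerivAt_id t).const_add 1)
    have d2 := (hasDerivAt_mul_log h2).comp t ((hasDerivAt_id t).const_sub 1)
    exact ((d1.add d2).div_const 2).congr_deriv (by ring)
  have hcont : ContinuousOn (fun t ↦ (log (1 + t) - log (1 - t)) / 2) (uIcc 0 α) := by
    rw [uIcc_of_le hα.1.le]
    refine ContinuousOn.div_const (ContinuousOn.sub ?_ ?_) 2
    · exact ContinuousOn.log (by fun_prop) fun t ht ↦ by linarith [ht.1]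
    · exact ContinuousOn.log (by fun_prop) fun t ht ↦ by linarith [ht.2, hα.2]
  have hftc := intervalIntegral.integral_eq_sub_of_hasDerivAt hderiv hcont.intervalIntegrable
  rw [show Cconst 0 = 0 by simp [Cconst], sub_zero,
    intervalIntegral.integral_of_le hα.1.le] at hftc
  rw [← hftc, logPot_mualpha hα, logPot_mualpha hα, neg_sub_neg, ← mul_sub,
    ← integral_sub (integrableOn_integral_arcsineKernel hα 1)
      (integrableOn_integral_arcsineKernel hα 0), ← integral_const_mul]
  refine setIntegral_congr_fun measurableSet_Ioc fun t ht ↦ ?_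
  have ht' : t ∈ Ioo (0 : ℝ) 1 := ⟨ht.1, ht.2.trans_lt hα.2⟩
  rw [integral_arcsineKernel_one ht', integral_arcsineKernel_of_abs_le ht' (by simp),
    log_sqrt (by nlinarith [ht'.1, ht'.2]), show 1 - t ^ 2 = (1 + t) * (1 - t) by ring,
    log_mul (by linarith [ht'.1]) (by linarith [ht'.2])]
  field_simp
  ring

theorem potential_min_difference (α : ℝ) (hα : α ∈ Set.Ioo (0 : ℝ) 1)
    (r : ℝ) (hr : r = Real.sqrt (1 - α ^ 2)) :
    sInf (logPot (mualpha α) '' Set.Icc (-r) r) -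
      sInf (logPot (mualpha α) '' Set.Icc (-1 : ℝ) 1) = Cconst α := by
  subst hr
  have h1 : IsLeast (logPot (mualpha α) '' Set.Icc (-√(1 - α ^ 2)) √(1 - α ^ 2))
      (logPot (mualpha α) 0) := by
    refine ⟨⟨0, by simp, rfl⟩, ?_⟩
    rintro _ ⟨x, hx, rfl⟩
    exact (logPot_mualpha_eq_zero hα (abs_le.mpr hx)).ge
  have h2 : IsLeast (logPot (mualpha α) '' Set.Icc (-1 : ℝ) 1) (logPot (mualpha α) 1) := by
    refine ⟨⟨1, by simp, rfl⟩, ?_⟩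
    rintro _ ⟨x, hx, rfl⟩
    exact logPot_mualpha_one_le hα (abs_le.mpr hx)
  rw [h1.csInf_eq, h2.csInf_eq, logPot_mualpha_zero_sub_one hα]
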